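/- Let k ≥ 2. Let H be a finite simple graph and C_H a collection of pairwise disjoint non-empty subsets of V(H) such that for each D ∈ C_H we have ē_H(D) ≤ (k-1)|D| + 1 and every vertex of D has degree at least k in H. Assume that H does not have a non-empty subgraph of minimum degree at least k. Then there exist a set S ⊆ V_{≤k-1}(H) with V_{≤k-2}(H) ⊆ S and Σ_{s∈S}(k - deg_H(s)) ≤ 2·((k-1)·v(H) - e(H)), as well as pairwise disjoint subsets B_v ⊆ V(H) for each v ∈ V_{≤k-1}(H)\S, such that the following holds: whenever H̃ is a finite simple graph containing H as a proper induced subgraph with V_{≤k-1}(H̃) ⊆ V_{≤k-1}(H)\S and such that no vertex of V(H̃)\V(H) is adjacent to any member of C_H, there exists a non-empty induced subgraph H̃' of H̃ with: (a) the minimum degree of H̃' is at least k; (b) (k-1)·v(H̃') - e(H̃') ≤ (k-1)·v(H̃) - e(H̃); (c) V(H̃)\V(H̃') ⊆ ⋃_{v ∈ V_{≤k-1}(H̃)} B_v; (d) no vertex of V(H̃)\V(H̃') is adjacent to any vertex of V(H̃)\V(H); (e) for each D ∈ C_H, either D ⊆ V(H̃') or D ∩ V(H̃') = ∅; (f) if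 D ∈ C_H and D ⊆ V(H̃'), then no vertex of D is adjacent to any vertex of V(H̃)\V(H̃'). -/

import Mathlib

universe u

/-- The number of edges of `H` incident with at least one vertex of `X`. -/
def eBar {V : Type u} [Fintype V] [DecidableEq V] (H : SimpleGraph V) [DecidableRel H.Adj]
    (X : Finset V) : ℕ :=
  (H.edgeFinset.filter (fun e => ∃ v ∈ X, v ∈ e)).card

set_option linter.unusedSectionVars false

section Abstract

variable {V : Type u} [DecidableEq V]

/-- A set is saturated if it is a union of pieces. -/
def KSat (P : V → Finset V) (X : Finset V) : Prop := ∀ v ∈ X, P v ⊆ X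

/-- The threshold for adding a piece. -/
def kc (m : Finset V → ℤ) (P : V → Finset V) (v : V) : ℤ := max 0 (m (P v) + 1)

/-- No further piece can be added. -/
def KClosed (m : Finset V → ℤ) (P : V → Finset V) (X : Finset V) : Prop :=
  ∀ v, v ∉ X → m (X ∪ P v) - m X < kc m P v

/-- Sets reachable from `U` by adding pieces. -/
inductive KReach (m : Finset V → ℤ) (P : V → Finset V) (U : Finset V) : Finset V → Prop
  | base : KReach m P U U
  | step (X : Finset V) (v : V) : KReach m P U X → v ∉ X →
      kc m P v ≤ m (X ∪ P v) - m X → KReach m P U (X ∪ P v)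

variable {m : Finset V → ℤ} {P : V → Finset V}

lemma KSat.disj (hP2 : ∀ u v, u ∈ P v → P u = P v) (hP1 : ∀ v, v ∈ P v)
    {G : Finset V} (hG : KSat P G) {v : V} (hv : v ∉ G) : Disjoint (P v) G := by
  rw [Finset.disjoint_left]
  intro u hu huG
  have := hG u huG
  rw [hP2 u v hu] at this
  exact hv (this (hP1 v))

lemma KSat.union {X Y : Finset V} (hX : KSat P X) (hY : KSat P Y) : KSat P (X ∪ Y) := by
  intro v hv
  rcases Finset.mem_union.1 hv with h | h
  · exact (hX v h).trans Finset.subset_union_left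
  · exact (hY v h).trans Finset.subset_union_right

lemma KSat.inter {X Y : Finset V} (hX : KSat P X) (hY : KSat P Y) : KSat P (X ∩ Y) := by
  intro v hv
  have h := Finset.mem_inter.1 hv
  exact Finset.subset_inter (hX v h.1) (hY v h.2)

lemma KSat.piece (hP2 : ∀ u v, u ∈ P v → P u = P v) (v : V) : KSat P (P v) := by
  intro u hu
  rw [hP2 u v hu]

lemma marg (hsup : ∀ X Y, m X + m Y ≤ m (X ∪ Y) + m (X ∩ Y)) {X G Q : Finset V}
    (hXG : X ⊆ G) (hd : Disjoint Q G) : m (X ∪ Q) - m X ≤ m (G ∪ Q) - m G := by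
  have h := hsup (X ∪ Q) G
  have h1 : (X ∪ Q) ∪ G = G ∪ Q := by
    ext a; simp only [Finset.mem_union]; have := @hXG a; tauto
  have h2 : (X ∪ Q) ∩ G = X := by
    ext a; simp only [Finset.mem_union, Finset.mem_inter]
    have := @hXG a
    have : a ∈ Q → a ∉ G := fun h => Finset.disjoint_left.1 hd h
    tauto
  rw [h1, h2] at h
  linarith

lemma kc_nonneg (v : V) : 0 ≤ kc m P v := le_max_left _ _

lemma KReach.sub {U X : Finset V} (h : KReach m P U X) : U ⊆ X := by
  induction h with
  | base => exact subset_rfl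
  | step X v _ _ _ ih => exact ih.trans Finset.subset_union_left

lemma KReach.sat (hP2 : ∀ u v, u ∈ P v → P u = P v) {U X : Finset V} (hU : KSat P U)
    (h : KReach m P U X) : KSat P X := by
  induction h with
  | base => exact hU
  | step X v _ _ _ ih => exact ih.union (KSat.piece hP2 v)

lemma KReach.exists_closed [Fintype V] (hP1 : ∀ v, v ∈ P v) (U : Finset V) :
    ∃ F, KReach m P U F ∧ KClosed m P F := by
  classical
  have hne : (Finset.univ.filter (fun X : Finset V => KReach m P U X)).Nonempty :=
    ⟨U, by simpa using KReach.base⟩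
  obtain ⟨F, hF, hmax⟩ := Finset.exists_max_image _ Finset.card hne
  simp only [Finset.mem_filter, Finset.mem_univ, true_and] at hF hmax
  refine ⟨F, hF, ?_⟩
  intro v hv
  by_contra hcon
  push Not at hcon
  have h2 := hmax _ (KReach.step F v hF hv hcon)
  have h3 : F ⊂ F ∪ P v := by
    refine ⟨Finset.subset_union_left, fun h => hv (h ?_)⟩
    exact Finset.mem_union_right _ (hP1 v)
  have := Finset.card_lt_card h3
  omega

lemma KReach.sub_closed (hsup : ∀ X Y, m X + m Y ≤ m (X ∪ Y) + m (X ∩ Y))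
    (hP1 : ∀ v, v ∈ P v) (hP2 : ∀ u v, u ∈ P v → P u = P v) {U X G : Finset V}
    (h : KReach m P U X) (hG : KSat P G) (hGc : KClosed m P G) (hUG : U ⊆ G) : X ⊆ G := by
  induction h with
  | base => exact hUG
  | step X v _ hv hc ih =>
    apply Finset.union_subset ih
    by_contra hcon
    have hvG : v ∉ G := fun hvG => hcon (hG v hvG)
    have h1 := marg hsup ih (hG.disj hP2 hP1 hvG)
    have h2 := hGc v hvG
    linarith

lemma KReach.sum_le (hP1 : ∀ v, v ∈ P v) (hP2 : ∀ u v, u ∈ P v → P u = P v)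
    {L U X : Finset V} (hL : ∀ v ∈ L, P v = {v})
    (h : KReach m P U X) : m U + ∑ p ∈ (X ∩ L) \ U, kc m P p ≤ m X := by
  induction h with
  | base =>
    have : (U ∩ L) \ U = ∅ := by ext a; simp; tauto
    simp [this]
  | step X v hr hv hc ih =>
    by_cases hvL : v ∈ L
    · have hPv := hL v hvL
      have h1 : ((X ∪ P v) ∩ L) \ U = insert v ((X ∩ L) \ U) := by
        have : v ∉ U := fun h => hv (hr.sub h)
        ext a; rw [hPv]
        simp only [Finset.mem_sdiff, Finset.mem_inter, Finset.mem_union, Finset.mem_singleton,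
          Finset.mem_insert]
        by_cases hav : a = v
        · subst hav; tauto
        · tauto
      rw [h1, Finset.sum_insert (by simp [hv])]
      linarith
    · have h1 : ((X ∪ P v) ∩ L) \ U = (X ∩ L) \ U := by
        ext a
        simp only [Finset.mem_sdiff, Finset.mem_inter, Finset.mem_union]
        have : a ∈ P v → a ∉ L := by
          intro ha haL
          have h2 := hP2 a v ha
          rw [hL a haL] at h2
          have h3 := hP1 v
          rw [← h2] at h3
          rw [Finset.mem_singleton] at h3
          exact hvL (h3 ▸ haL)
        tauto
      rw [h1]
      have := kc_nonneg (m := m) (P := P) v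
      linarith

lemma KReach.inter_le (hsup : ∀ X Y, m X + m Y ≤ m (X ∪ Y) + m (X ∩ Y))
    (hP1 : ∀ v, v ∈ P v) (hP2 : ∀ u v, u ∈ P v → P u = P v) {U X C E : Finset V}
    (hU : KSat P U)
    (h : KReach m P U X) (hC : KSat P C) (hE : KSat P E) (hEc : KClosed m P E)
    (hUC : U ∩ C ⊆ E) :
    m (X ∩ C) - m (U ∩ C) ≤ m X - m U ∧
    (X ∩ C ⊆ E ∨ m (X ∩ C) - m (U ∩ C) < m X - m U) := by
  induction h with
  | base => exact ⟨by simp, Or.inl hUC⟩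
  | step X v hr hv hc ih =>
    have hc0 := kc_nonneg (m := m) (P := P) v
    by_cases hvC : v ∈ C
    · have h1 : (X ∪ P v) ∩ C = (X ∩ C) ∪ P v := by
        rw [Finset.union_inter_distrib_right, Finset.inter_eq_left.2 (hC v hvC)]
      rw [h1]
      have hd := (hr.sat hP2 hU).disj hP2 hP1 hv
      have h2 := marg hsup (Finset.inter_subset_left (s₁ := X) (s₂ := C)) hd
      refine ⟨by linarith [ih.1], ?_⟩
      rcases ih.2 with h3 | h3
      · by_cases hvE : v ∈ E
        · exact Or.inl (Finset.union_subset h3 (hE v hvE))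
        · right
          have h4 := marg hsup h3 (hE.disj hP2 hP1 hvE)
          have h5 := hEc v hvE
          linarith [ih.1]
      · right; linarith
    · have h1 : (X ∪ P v) ∩ C = X ∩ C := by
        rw [Finset.union_inter_distrib_right,
          Finset.disjoint_iff_inter_eq_empty.1 (hC.disj hP2 hP1 hvC), Finset.union_empty]
      rw [h1]
      refine ⟨by linarith [ih.1], ?_⟩
      rcases ih.2 with h3 | h3
      · exact Or.inl h3
      · right; linarith

lemma sum_le_m (hm0 : m ∅ = 0) (hsup : ∀ X Y, m X + m Y ≤ m (X ∪ Y) + m (X ∩ Y))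
    (U : Finset V) : ∑ u ∈ U, m {u} ≤ m U := by
  induction U using Finset.induction_on with
  | empty => simp [hm0]
  | insert a s ha ih =>
    rw [Finset.sum_insert ha]
    have h := hsup {a} s
    have h1 : ({a} : Finset V) ∩ s = ∅ := Finset.singleton_inter_of_notMem ha
    rw [h1, hm0, ← Finset.insert_eq] at h
    linarith

theorem abstract_main [Fintype V] (hm0 : m ∅ = 0)
    (hsup : ∀ X Y, m X + m Y ≤ m (X ∪ Y) + m (X ∩ Y))
    (hP1 : ∀ v, v ∈ P v) (hP2 : ∀ u v, u ∈ P v → P u = P v)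
    (L : Finset V) (hL : ∀ v ∈ L, P v = {v}) (hLm : ∀ v ∈ L, 0 ≤ m {v}) :
    ∃ (R T : Finset V) (sh : Finset V → Finset V) (g : V → V),
      R ⊆ L ∧ R ⊆ T ∧ (L.Nonempty → T.Nonempty) ∧ KSat P T ∧ KClosed m P T ∧
      (∀ G, KSat P G → KClosed m P G → L ⊆ G → T ⊆ G) ∧
      (∑ p ∈ (T ∩ L) \ R, kc m P p ≤ 2 * m T) ∧
      ∀ Y ⊆ R, Y ⊆ sh Y ∧ sh Y ⊆ T ∧ KSat P (sh Y) ∧ KClosed m P (sh Y) ∧ 0 ≤ m Y ∧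
        (∀ C, KSat P C → Y ⊆ C → C ⊆ sh Y → m C ≤ 0) ∧ ∀ z ∈ sh Y, g z ∈ Y := by
  classical
  have hsatL : ∀ Y ⊆ L, KSat P Y := by
    intro Y hY v hv
    rw [hL v (hY hv)]; simpa using hv
  have hmL : ∀ Y ⊆ L, 0 ≤ m Y := fun Y hY =>
    (Finset.sum_nonneg fun v hv => hLm v (hY hv)).trans (sum_le_m hm0 hsup Y)
  choose sh hshr hshc using fun U => KReach.exists_closed (m := m) (P := P) hP1 U
  have hshs : ∀ Y ⊆ L, KSat P (sh Y) := fun Y hY => (hshr Y).sat hP2 (hsatL Y hY)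
  have hshmin : ∀ Y G, KSat P G → KClosed m P G → Y ⊆ G → sh Y ⊆ G :=
    fun Y G h1 h2 h3 => (hshr Y).sub_closed hsup hP1 hP2 h1 h2 h3
  have hmono : ∀ X Y, Y ⊆ L → X ⊆ Y → sh X ⊆ sh Y := fun X Y hY hXY =>
    hshmin X _ (hshs Y hY) (hshc Y) (hXY.trans (hshr Y).sub)
  have hshe : sh ∅ = ∅ := by
    apply Finset.subset_empty.1
    apply hshmin _ _ _ _ subset_rfl
    · intro v hv; simp at hv
    · intro v _
      rw [Finset.empty_union, hm0]
      have : m (P v) + 1 ≤ kc m P v := le_max_right _ _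
      linarith
  have hcL : ∀ v ∈ L, kc m P v = m {v} + 1 := by
    intro v hv
    rw [kc, hL v hv]
    exact max_eq_right (by linarith [hLm v hv])
  have hge : ∀ Y ⊆ L, m Y + ∑ p ∈ (sh Y ∩ L) \ Y, kc m P p ≤ m (sh Y) :=
    fun Y _ => (hshr Y).sum_le hP1 hP2 hL
  have hge0 : ∀ Y ⊆ L, m Y ≤ m (sh Y) := by
    intro Y hY
    have h1 := hge Y hY
    have h2 : 0 ≤ ∑ p ∈ (sh Y ∩ L) \ Y, kc m P p := Finset.sum_nonneg fun p _ => kc_nonneg p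
    linarith
  have hCle : ∀ Y ⊆ L, ∀ C, KSat P C → Y ⊆ C → C ⊆ sh Y → m C ≤ m (sh Y) := by
    intro Y hY C hC hYC hCs
    have h := ((hshr Y).inter_le hsup hP1 hP2 (hsatL Y hY) hC (hshs Y hY) (hshc Y)
      (Finset.inter_subset_left.trans (hshr Y).sub)).1
    rw [Finset.inter_eq_right.2 hCs, Finset.inter_eq_left.2 hYC] at h
    linarith
  -- tight families
  have fam : ∀ R ⊆ L, (∀ Y ⊆ R, m (sh Y) = 0) → ∃ g : V → V, ∀ Y ⊆ R, ∀ z ∈ sh Y, g z ∈ Y := by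
    intro R hR ht
    have hmR : ∀ Y ⊆ R, m Y = 0 := fun Y hY =>
      le_antisymm (by linarith [hge0 Y (hY.trans hR), ht Y hY]) (hmL Y (hY.trans hR))
    have hshL : ∀ Y ⊆ R, sh Y ∩ L ⊆ Y := by
      intro Y hY v hv
      by_contra hvY
      have h1 := hge Y (hY.trans hR)
      rw [hmR Y hY, ht Y hY] at h1
      have h2 : kc m P v ≤ ∑ p ∈ (sh Y ∩ L) \ Y, kc m P p :=
        Finset.single_le_sum (fun p _ => kc_nonneg p) (Finset.mem_sdiff.2 ⟨hv, hvY⟩)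
      have hvL := (Finset.mem_inter.1 hv).2
      rw [hcL v hvL] at h2
      linarith [hLm v hvL]
    have hint : ∀ X ⊆ R, ∀ Y ⊆ R, sh X ∩ sh Y ⊆ sh (X ∩ Y) := by
      intro X hX Y hY
      have hXY : X ∩ Y ⊆ R := Finset.inter_subset_left.trans hX
      have hsC : KSat P (sh X ∩ sh Y) := (hshs X (hX.trans hR)).inter (hshs Y (hY.trans hR))
      have hXC : X ∩ (sh X ∩ sh Y) ⊆ sh (X ∩ Y) := by
        intro a ha
        simp only [Finset.mem_inter] at ha
        apply (hshr _).sub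
        exact Finset.mem_inter.2 ⟨ha.1, hshL Y hY (Finset.mem_inter.2 ⟨ha.2.2, hR (hX ha.1)⟩)⟩
      have h := ((hshr X).inter_le hsup hP1 hP2 (hsatL X (hX.trans hR)) hsC
        (hshs _ (hXY.trans hR)) (hshc (X ∩ Y)) hXC).2
      rw [← Finset.inter_assoc, Finset.inter_self] at h
      rcases h with h | h
      · exact h
      · exfalso
        rw [ht X hX, hmR X hX, hmR _ (Finset.inter_subset_left.trans hX)] at h
        have h1 := hsup (sh X) (sh Y)
        rw [ht X hX, ht Y hY] at h1
        have hU : X ∪ Y ⊆ R := Finset.union_subset hX hY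
        have h2 := hCle (X ∪ Y) (hU.trans hR) (sh X ∪ sh Y)
          ((hshs X (hX.trans hR)).union (hshs Y (hY.trans hR)))
          (Finset.union_subset_union (hshr X).sub (hshr Y).sub)
          (Finset.union_subset (hmono _ _ (hU.trans hR) Finset.subset_union_left)
            (hmono _ _ (hU.trans hR) Finset.subset_union_right))
        rw [ht _ hU] at h2
        linarith
    have hex : ∀ z, ∃ v, ∀ Y ⊆ R, z ∈ sh Y → v ∈ Y := by
      intro z
      by_cases hz : ∃ Y, Y ⊆ R ∧ z ∈ sh Y
      · have hne : (Finset.univ.filter (fun Y : Finset V => Y ⊆ R ∧ z ∈ sh Y)).Nonempty := by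
          obtain ⟨Y, hY⟩ := hz
          exact ⟨Y, by simpa using hY⟩
        obtain ⟨Y, hY, hmin⟩ := Finset.exists_min_image _ Finset.card hne
        simp only [Finset.mem_filter, Finset.mem_univ, true_and] at hY hmin
        have hYne : Y.Nonempty := by
          rw [Finset.nonempty_iff_ne_empty]
          rintro rfl
          rw [hshe] at hY
          simp at hY
        obtain ⟨v, hv⟩ := hYne
        refine ⟨v, fun Y' hY' hzY' => ?_⟩
        have h1 := hint Y hY.1 Y' hY' (Finset.mem_inter.2 ⟨hY.2, hzY'⟩)
        have h2 := hmin (Y ∩ Y') ⟨Finset.inter_subset_left.trans hY.1, h1⟩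
        have h3 := Finset.eq_of_subset_of_card_le Finset.inter_subset_left h2
        rw [← h3] at hv
        exact (Finset.mem_inter.1 hv).2
      · exact ⟨z, fun Y h1 h2 => absurd ⟨Y, h1, h2⟩ hz⟩
    choose g hg using hex
    exact ⟨g, fun Y hY z hz => hg z Y hY hz⟩
  by_cases hall : ∀ Y ⊆ L, m (sh Y) = 0
  · obtain ⟨g, hg⟩ := fam L subset_rfl hall
    refine ⟨L, sh L, sh, g, subset_rfl, (hshr L).sub, fun h => h.mono (hshr L).sub,
      hshs L subset_rfl, hshc L, fun G h1 h2 h3 => hshmin L G h1 h2 h3, ?_, ?_⟩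
    · have : (sh L ∩ L) \ L = ∅ := by ext a; simp
      rw [this, hall L subset_rfl]; simp
    · intro Y hY
      exact ⟨(hshr Y).sub, hmono _ _ subset_rfl hY, hshs Y hY, hshc Y, hmL Y hY,
        fun C h1 h2 h3 => (hall Y hY) ▸ hCle Y hY C h1 h2 h3, hg Y hY⟩
  · have hne : (Finset.univ.filter (fun Y : Finset V => Y ⊆ L ∧ m (sh Y) ≠ 0)).Nonempty := by
      push Not at hall
      obtain ⟨Y, hY⟩ := hall
      exact ⟨Y, by simpa using hY⟩
    obtain ⟨U, hU, hmin⟩ := Finset.exists_min_image _ Finset.card hne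
    simp only [Finset.mem_filter, Finset.mem_univ, true_and] at hU hmin
    have hUne : U.Nonempty := by
      rw [Finset.nonempty_iff_ne_empty]
      rintro rfl
      rw [hshe] at hU
      exact hU.2 hm0
    obtain ⟨u0, hu0⟩ := hUne
    have hRU : U.erase u0 ⊆ U := Finset.erase_subset _ _
    have htR : ∀ Y ⊆ U.erase u0, m (sh Y) = 0 := by
      intro Y hY
      by_contra hcon
      have h1 := hmin Y ⟨(hY.trans hRU).trans hU.1, hcon⟩
      have h2 := Finset.card_le_card hY
      have h3 := Finset.card_erase_lt_of_mem hu0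
      omega
    obtain ⟨g, hg⟩ := fam _ (hRU.trans hU.1) htR
    refine ⟨U.erase u0, sh U, sh, g, hRU.trans hU.1, hRU.trans (hshr U).sub,
      fun _ => ⟨u0, (hshr U).sub hu0⟩,
      hshs U hU.1, hshc U, fun G h1 h2 h3 => hshmin U G h1 h2 (hU.1.trans h3), ?_, ?_⟩
    · have h1 : (sh U ∩ L) \ (U.erase u0) = insert u0 ((sh U ∩ L) \ U) := by
        ext a
        have h2 := (hshr U).sub hu0
        have h3 := hU.1 hu0
        simp only [Finset.mem_sdiff, Finset.mem_inter, Finset.mem_erase, Finset.mem_insert]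
        by_cases hav : a = u0
        · subst hav; tauto
        · tauto
      rw [h1, Finset.sum_insert (by simp [hu0]), hcL u0 (hU.1 hu0)]
      have h2 := hge U hU.1
      have h3 : m {u0} ≤ m U := (Finset.single_le_sum (f := fun u => m {u})
        (fun v hv => hLm v (hU.1 hv)) hu0).trans (sum_le_m hm0 hsup U)
      have h4 : 0 ≤ m (sh U) := (hmL U hU.1).trans (hge0 U hU.1)
      have h5 : 0 < m (sh U) := lt_of_le_of_ne h4 (Ne.symm hU.2)
      linarith
    · intro Y hY
      have hYL := (hY.trans hRU).trans hU.1
      exact ⟨(hshr Y).sub, hmono _ _ hU.1 (hY.trans hRU), hshs Y hYL, hshc Y, hmL Y hYL,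
        fun C h1 h2 h3 => (htR Y hY) ▸ hCle Y hYL C h1 h2 h3, hg Y hY⟩

end Abstract

section Graph

variable {V : Type u} [Fintype V] [DecidableEq V]

open Classical in
/-- Degree of `v` into `A`. -/
noncomputable def dg (G : SimpleGraph V) (A : Finset V) (v : V) : ℕ :=
  (A.filter (fun u => G.Adj v u)).card

open Classical in
/-- Edges of `G` inside `A` that meet `X`. -/
noncomputable def ebS (G : SimpleGraph V) (A X : Finset V) : Finset (Sym2 V) :=
  Finset.univ.filter (fun e => e ∈ G.edgeSet ∧ (∀ x ∈ e, x ∈ A) ∧ ∃ x ∈ X, x ∈ e)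

/-- Number of edges of `G` inside `A` that meet `X`. -/
noncomputable def eb (G : SimpleGraph V) (A X : Finset V) : ℕ := (ebS G A X).card

/-- The slack function. -/
noncomputable def km (k : ℕ) (G : SimpleGraph V) (A X : Finset V) : ℤ :=
  ((k : ℤ) - 1) * (X.card : ℤ) - (eb G A X : ℤ)

variable {G : SimpleGraph V} {A X Y T : Finset V} {k : ℕ}

lemma mem_ebS {e : Sym2 V} : e ∈ ebS G A X ↔
    e ∈ G.edgeSet ∧ (∀ x ∈ e, x ∈ A) ∧ ∃ x ∈ X, x ∈ e := by
  simp [ebS]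

lemma km_empty : km k G A ∅ = 0 := by
  simp [km, eb, ebS]

lemma ebS_union : ebS G A (X ∪ Y) = ebS G A X ∪ ebS G A Y := by
  ext e
  simp only [mem_ebS, Finset.mem_union]
  constructor
  · rintro ⟨h1, h2, x, h3 | h3, h4⟩
    · exact Or.inl ⟨h1, h2, x, h3, h4⟩
    · exact Or.inr ⟨h1, h2, x, h3, h4⟩
  · rintro (⟨h1, h2, x, h3, h4⟩ | ⟨h1, h2, x, h3, h4⟩)
    · exact ⟨h1, h2, x, Or.inl h3, h4⟩
    · exact ⟨h1, h2, x, Or.inr h3, h4⟩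

lemma ebS_inter : ebS G A (X ∩ Y) ⊆ ebS G A X ∩ ebS G A Y := by
  intro e
  simp only [mem_ebS, Finset.mem_inter]
  rintro ⟨h1, h2, x, h3, h4⟩
  exact ⟨⟨h1, h2, x, h3.1, h4⟩, ⟨h1, h2, x, h3.2, h4⟩⟩

lemma km_sup (X Y : Finset V) :
    km k G A X + km k G A Y ≤ km k G A (X ∪ Y) + km k G A (X ∩ Y) := by
  have h1 := Finset.card_union_add_card_inter X Y
  have h2 := Finset.card_union_add_card_inter (ebS G A X) (ebS G A Y)
  have h3 := Finset.card_le_card (ebS_inter (G := G) (A := A) (X := X) (Y := Y))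
  rw [← ebS_union] at h2
  simp only [km, eb]
  zify at h1 h2 h3
  have h4 : ((k : ℤ) - 1) * ((X ∪ Y).card : ℤ) + ((k : ℤ) - 1) * ((X ∩ Y).card : ℤ)
    = ((k : ℤ) - 1) * (X.card : ℤ) + ((k : ℤ) - 1) * (Y.card : ℤ) := by
    rw [← mul_add, h1, mul_add]
  linarith

lemma km_adj (hd : Disjoint X Y) {x y : V} (hx : x ∈ X) (hy : y ∈ Y) (hxA : x ∈ A)
    (hyA : y ∈ A) (h : G.Adj x y) : km k G A Y + 1 ≤ km k G A (X ∪ Y) - km k G A X := by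
  have h1 := Finset.card_union_of_disjoint hd
  have h2 := Finset.card_union_add_card_inter (ebS G A X) (ebS G A Y)
  rw [← ebS_union] at h2
  have h3 : 0 < (ebS G A X ∩ ebS G A Y).card := by
    apply Finset.card_pos.2
    refine ⟨s(x, y), ?_⟩
    have hA : ∀ z ∈ s(x, y), z ∈ A := by
      intro z hz
      rcases Sym2.mem_iff.1 hz with rfl | rfl <;> assumption
    simp only [Finset.mem_inter, mem_ebS]
    exact ⟨⟨h, hA, x, hx, by simp⟩, ⟨h, hA, y, hy, by simp⟩⟩
  simp only [km, eb]
  zify at h1 h2 h3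
  rw [h1]
  linarith

lemma eb_contract : eb G A (T ∪ X) = eb G A T + eb G (A \ T) X := by
  have h1 : ebS G A (T ∪ X) = ebS G A T ∪ ebS G (A \ T) X := by
    ext e
    simp only [mem_ebS, Finset.mem_union, Finset.mem_sdiff]
    constructor
    · rintro ⟨h1, h2, x, h3, h4⟩
      by_cases hT : ∃ t ∈ T, t ∈ e
      · exact Or.inl ⟨h1, h2, hT⟩
      · right
        refine ⟨h1, fun y hy => ⟨h2 y hy, fun hyT => hT ⟨y, hyT, hy⟩⟩, x, ?_, h4⟩
        rcases h3 with h3 | h3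
        · exact absurd ⟨x, h3, h4⟩ hT
        · exact h3
    · rintro (⟨h1, h2, x, h3, h4⟩ | ⟨h1, h2, x, h3, h4⟩)
      · exact ⟨h1, h2, x, Or.inl h3, h4⟩
      · exact ⟨h1, fun y hy => (h2 y hy).1, x, Or.inr h3, h4⟩
  have h2 : Disjoint (ebS G A T) (ebS G (A \ T) X) := by
    rw [Finset.disjoint_left]
    intro e h1 h2
    rw [mem_ebS] at h1 h2
    obtain ⟨_, _, x, hx, hxe⟩ := h1
    exact (Finset.mem_sdiff.1 (h2.2.1 x hxe)).2 hx
  rw [eb, h1, Finset.card_union_of_disjoint h2]; rfl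

lemma eb_singleton {v : V} (hv : v ∈ A) : eb G A {v} = dg G A v := by
  classical
  have h1 : ebS G A {v} = (A.filter (fun u => G.Adj v u)).image (fun u => s(v, u)) := by
    ext e
    induction e using Sym2.ind with
    | _ a b =>
      simp only [mem_ebS, Finset.mem_image, Finset.mem_filter, Finset.mem_singleton,
        SimpleGraph.mem_edgeSet]
      constructor
      · rintro ⟨h1, h2, x, rfl, h4⟩
        rcases Sym2.mem_iff.1 h4 with rfl | rfl
        · exact ⟨b, ⟨h2 b (by simp), h1⟩, rfl⟩
        · exact ⟨a, ⟨h2 a (by simp), h1.symm⟩, Sym2.eq_swap⟩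
      · rintro ⟨u, ⟨h1, h2⟩, h3⟩
        rw [← SimpleGraph.mem_edgeSet, ← h3]
        refine ⟨h2, ?_, v, rfl, by simp⟩
        intro z hz
        rcases Sym2.mem_iff.1 hz with rfl | rfl <;> assumption
  rw [eb, h1, Finset.card_image_of_injective, dg]
  intro a b hab
  have hab' : s(v, a) = s(v, b) := hab
  exact Sym2.congr_right.1 hab'

lemma km_singleton {v : V} (hv : v ∈ A) : km k G A {v} = (k : ℤ) - 1 - dg G A v := by
  simp [km, eb_singleton hv]

lemma km_insert {v : V} (hv : v ∈ A) (hvX : v ∉ X) :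
    km k G A (X ∪ {v}) = km k G A X + ((k : ℤ) - 1 - dg G (A \ X) v) := by
  have h : (X ∪ {v}).card = X.card + 1 := by
    rw [Finset.card_union_of_disjoint (by simpa using hvX)]; simp
  have hv' : v ∈ A \ X := Finset.mem_sdiff.2 ⟨hv, hvX⟩
  simp only [km, eb_contract, eb_singleton hv', h]
  push_cast
  ring

lemma km_split (hT : T ⊆ A) : km k G A A = km k G A T + km k G (A \ T) (A \ T) := by
  have h1 : T ∪ (A \ T) = A := Finset.union_sdiff_of_subset hT
  have h2 : eb G A A = eb G A T + eb G (A \ T) (A \ T) := by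
    rw [← eb_contract, h1]
  have h3 := Finset.card_sdiff_add_card_eq_card hT
  simp only [km, h2]
  rw [← h3]
  push_cast
  ring

lemma km_outside (hd : Disjoint X A) :
    km k G A (A ∪ X) = km k G A A + km k G A X := by
  have h1 : ebS G A X = ∅ := by
    ext e
    simp only [mem_ebS, Finset.notMem_empty, iff_false]
    rintro ⟨_, h2, x, h3, h4⟩
    exact Finset.disjoint_left.1 hd h3 (h2 x h4)
  have h2 := Finset.card_union_of_disjoint hd.symm
  simp only [km, eb, ebS_union, h1, h2]
  push_cast
  simp
  ring

lemma dg_mono (h : X ⊆ Y) (v : V) : dg G X v ≤ dg G Y v := by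
  classical
  exact Finset.card_le_card (Finset.filter_subset_filter _ h)

lemma dg_eq_of_not_adj (h : X ⊆ Y) {v : V} (hn : ∀ y ∈ Y, y ∉ X → ¬ G.Adj v y) :
    dg G X v = dg G Y v := by
  classical
  unfold dg
  congr 1
  ext y
  simp only [Finset.mem_filter]
  constructor
  · rintro ⟨h1, h2⟩; exact ⟨h h1, h2⟩
  · rintro ⟨h1, h2⟩
    refine ⟨?_, h2⟩
    by_contra hy
    exact hn y h1 hy h2

variable {W : Type u} [Fintype W] [DecidableEq W] {K : SimpleGraph W} {f : V ↪ W}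

lemma dg_map (hf : ∀ u v, K.Adj (f u) (f v) ↔ G.Adj u v) {Z : Finset W}
    (h : X.map f ⊆ Z) (v : V) : dg G X v ≤ dg K Z (f v) ∧
    (dg K Z (f v) ≤ dg G X v → ∀ y ∈ Z, K.Adj (f v) y → y ∈ X.map f) := by
  classical
  have h1 : (X.filter (fun u => G.Adj v u)).map f ⊆ Z.filter (fun u => K.Adj (f v) u) := by
    intro y hy
    obtain ⟨x, hx, rfl⟩ := Finset.mem_map.1 hy
    obtain ⟨h1, h2⟩ := Finset.mem_filter.1 hx
    exact Finset.mem_filter.2 ⟨h (Finset.mem_map_of_mem f h1), (hf _ _).2 h2⟩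
  have h2 : ((X.filter (fun u => G.Adj v u)).map f).card = dg G X v := by
    rw [Finset.card_map, dg]
  have h3 : (Z.filter (fun u => K.Adj (f v) u)).card = dg K Z (f v) := by
    rw [dg]
  refine ⟨?_, fun hle y hy hadj => ?_⟩
  · rw [← h2, ← h3]
    exact Finset.card_le_card h1
  · have h4 := Finset.eq_of_subset_of_card_le h1 (by rw [h2, h3]; exact hle)
    have h5 : y ∈ Z.filter (fun u => K.Adj (f v) u) := Finset.mem_filter.2 ⟨hy, hadj⟩
    rw [← h4] at h5
    obtain ⟨x, hx, rfl⟩ := Finset.mem_map.1 h5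
    exact Finset.mem_map_of_mem f (Finset.mem_filter.1 hx).1

lemma km_map (hf : ∀ u v, K.Adj (f u) (f v) ↔ G.Adj u v) {Z : Finset W}
    (hn : ∀ x ∈ X, ∀ y ∈ Z, y ∉ A.map f → ¬ K.Adj (f x) y) (hXA : X ⊆ A) :
    km k G A X ≤ km k K Z (X.map f) := by
  have h1 : ebS K Z (X.map f) ⊆ (ebS G A X).image (Sym2.map f) := by
    have key : ∀ x ∈ X, ∀ b : W, K.Adj (f x) b → b ∈ Z →
        s(f x, b) ∈ (ebS G A X).image (Sym2.map f) := by
      intro x hx b hab hb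
      have hb' : b ∈ A.map f := by
        by_contra hcon
        exact hn x hx b hb hcon hab
      obtain ⟨y, hy, rfl⟩ := Finset.mem_map.1 hb'
      refine Finset.mem_image.2 ⟨s(x, y), ?_, by simp⟩
      rw [mem_ebS]
      refine ⟨(hf _ _).1 hab, ?_, x, hx, by simp⟩
      intro z hz
      rcases Sym2.mem_iff.1 hz with rfl | rfl
      · exact hXA hx
      · exact hy
    intro e
    induction e using Sym2.ind with
    | _ a b =>
      rw [mem_ebS]
      rintro ⟨h1, h2, w, h3, h4⟩
      obtain ⟨x, hx, rfl⟩ := Finset.mem_map.1 h3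
      rw [SimpleGraph.mem_edgeSet] at h1
      rcases Sym2.mem_iff.1 h4 with rfl | rfl
      · exact key x hx b h1 (h2 b (by simp))
      · rw [Sym2.eq_swap]
        exact key x hx a h1.symm (h2 a (by simp))
  have h2 := (Finset.card_le_card h1).trans Finset.card_image_le
  simp only [km, eb, Finset.card_map]
  zify at h2
  linarith

end Graph

section Main

variable {V : Type u} [Fintype V] [DecidableEq V]

open Classical in
/-- The piece of a vertex. -/
noncomputable def pc (CH : Finset (Finset V)) (v : V) : Finset V :=
  if h : ∃ D ∈ CH, v ∈ D then h.choose else {v}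

lemma pc_of_mem {CH : Finset (Finset V)}
    (hd : ∀ D₁ ∈ CH, ∀ D₂ ∈ CH, D₁ ≠ D₂ → Disjoint D₁ D₂) {D : Finset V} (hD : D ∈ CH)
    {v : V} (hv : v ∈ D) : pc CH v = D := by
  have h : ∃ D ∈ CH, v ∈ D := ⟨D, hD, hv⟩
  rw [pc, dif_pos h]
  by_contra hne
  exact Finset.disjoint_left.1 (hd _ h.choose_spec.1 _ hD hne) h.choose_spec.2 hv

lemma pc_of_not_mem {CH : Finset (Finset V)} {v : V} (hv : ∀ D ∈ CH, v ∉ D) :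
    pc CH v = {v} := by
  rw [pc, dif_neg]
  rintro ⟨D, hD, h⟩
  exact hv D hD h

lemma pc_self {CH : Finset (Finset V)}
    (hd : ∀ D₁ ∈ CH, ∀ D₂ ∈ CH, D₁ ≠ D₂ → Disjoint D₁ D₂) (v : V) : v ∈ pc CH v := by
  by_cases h : ∃ D ∈ CH, v ∈ D
  · obtain ⟨D, hD, hv⟩ := h
    rw [pc_of_mem hd hD hv]; exact hv
  · push Not at h
    rw [pc_of_not_mem h]; simp

lemma pc_eq {CH : Finset (Finset V)}
    (hd : ∀ D₁ ∈ CH, ∀ D₂ ∈ CH, D₁ ≠ D₂ → Disjoint D₁ D₂) (u v : V) (hu : u ∈ pc CH v) :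
    pc CH u = pc CH v := by
  by_cases h : ∃ D ∈ CH, v ∈ D
  · obtain ⟨D, hD, hv⟩ := h
    rw [pc_of_mem hd hD hv] at hu ⊢
    exact pc_of_mem hd hD hu
  · push Not at h
    rw [pc_of_not_mem h] at hu
    rw [Finset.mem_singleton.1 hu]

/-- The extension property for the induced subgraph of `H` on `A`. -/
def KExt (k : ℕ) (H : SimpleGraph V) (CH : Finset (Finset V)) (A S : Finset V)
    (B : V → Finset V) : Prop :=
  ∀ (W : Type u) [Fintype W] [DecidableEq W] (Ht : SimpleGraph W) (f : V ↪ W) (Z : Finset W),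
    (∀ u v : V, Ht.Adj (f u) (f v) ↔ H.Adj u v) →
    A.map f ⊆ Z →
    (∃ x ∈ Z, x ∉ A.map f) →
    (∀ x ∈ Z, dg Ht Z x ≤ k - 1 → ∃ v ∈ A, dg H A v ≤ k - 1 ∧ v ∉ S ∧ f v = x) →
    (∀ x ∈ Z, x ∉ A.map f → ∀ D ∈ CH, D ⊆ A → ∀ d ∈ D, ¬ Ht.Adj x (f d)) →
    ∃ s ⊆ Z, s.Nonempty ∧
      (∀ x ∈ s, k ≤ dg Ht s x) ∧
      (km k Ht s s ≤ km k Ht Z Z) ∧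
      (∀ x ∈ Z, x ∉ s → ∃ v ∈ A, dg Ht Z (f v) ≤ k - 1 ∧ ∃ b ∈ B v, f b = x) ∧
      (∀ x ∈ Z, x ∉ s → ∀ y ∈ Z, y ∉ A.map f → ¬ Ht.Adj x y) ∧
      (∀ D ∈ CH, D ⊆ A → (∀ d ∈ D, f d ∈ s) ∨ (∀ d ∈ D, f d ∉ s)) ∧
      (∀ D ∈ CH, D ⊆ A → (∀ d ∈ D, f d ∈ s) → ∀ d ∈ D, ∀ y ∈ Z, y ∉ s → ¬ Ht.Adj (f d) y)

/-- The deletion step in the larger graph. -/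
lemma deletion_step {k : ℕ} {H : SimpleGraph V} {CH : Finset (Finset V)}
    (hk : 2 ≤ k)
    (hd : ∀ D₁ ∈ CH, ∀ D₂ ∈ CH, D₁ ≠ D₂ → Disjoint D₁ D₂)
    {A : Finset V}
    (hDm : ∀ D ∈ CH, D ⊆ A → -1 ≤ km k H A D)
    (hDA : ∀ D ∈ CH, D ⊆ A ∨ Disjoint D A)
    {Y F : Finset V} (hYA : Y ⊆ A) (hFA : F ⊆ A) (hYF : Y ⊆ F)
    (hYlow : ∀ v ∈ Y, k - 1 ≤ dg H A v) (hYsat : KSat (pc CH) Y)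
    (hFs : KSat (pc CH) F) (hFc : KClosed (km k H A) (pc CH) F)
    (hY0 : 0 ≤ km k H A Y)
    (hFt : ∀ C, KSat (pc CH) C → Y ⊆ C → C ⊆ F → km k H A C ≤ 0)
    {W : Type u} [Fintype W] [DecidableEq W] {Ht : SimpleGraph W} {f : V ↪ W} {Z : Finset W}
    (hf : ∀ u v : V, Ht.Adj (f u) (f v) ↔ H.Adj u v)
    (hAZ : A.map f ⊆ Z)
    (hYt : ∀ v ∈ Y, dg Ht Z (f v) ≤ k - 1)
    (hout : ∀ x ∈ Z, x ∉ A.map f → ∀ D ∈ CH, D ⊆ A → ∀ d ∈ D, ¬ Ht.Adj x (f d)) :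
    ∃ K ⊆ F, Y ⊆ K ∧ KSat (pc CH) K ∧ 0 ≤ km k H A K ∧
      (∀ x ∈ K, ∀ y ∈ Z, y ∉ A.map f → ¬ Ht.Adj (f x) y) ∧
      (∀ D ∈ CH, D ⊆ A → Disjoint D K → ∀ d ∈ D, ∀ x ∈ K, ¬ H.Adj x d) ∧
      (∀ p ∈ Z, p ∉ K.map f → (∃ x ∈ K, Ht.Adj (f x) p) → k ≤ dg Ht (Z \ K.map f) p) := by
  classical
  let good : Finset V → Prop := fun K => K ⊆ F ∧ Y ⊆ K ∧ KSat (pc CH) K ∧ 0 ≤ km k H A K ∧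
      (∀ x ∈ K, ∀ y ∈ Z, y ∉ A.map f → ¬ Ht.Adj (f x) y)
  have hne : (Finset.univ.filter good).Nonempty := by
    refine ⟨Y, Finset.mem_filter.2 ⟨Finset.mem_univ _, hYF, subset_rfl, hYsat, hY0, ?_⟩⟩
    intro x hx y hy hyA hadj
    exact hyA ((dg_map hf hAZ x).2 ((hYt x hx).trans (hYlow x hx)) y hy hadj)
  obtain ⟨K, hK, hmax⟩ := Finset.exists_max_image _ Finset.card hne
  simp only [Finset.mem_filter, Finset.mem_univ, true_and] at hK hmax
  obtain ⟨hKF, hYK, hKs, hK0, hKo⟩ := hK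
  have hKA := hKF.trans hFA
  -- anything addable in `H` to `K` lies in `F`
  have haddF : ∀ v, v ∉ K → kc (km k H A) (pc CH) v ≤ km k H A (K ∪ pc CH v) - km k H A K →
      pc CH v ⊆ F := by
    intro v hvK hc
    by_contra hcon
    have hvF : v ∉ F := fun h => hcon (hFs v h)
    have h1 := marg (m := km k H A) km_sup hKF (hFs.disj (pc_eq hd) (pc_self hd) hvF)
    have h2 := hFc v hvF
    linarith
  have hnogood : ∀ v, v ∉ K → ¬ good (K ∪ pc CH v) := by
    intro v hv hg
    have h1 := hmax _ hg
    have h3 : K ⊂ K ∪ pc CH v := by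
      refine ⟨Finset.subset_union_left, fun h => hv (h ?_)⟩
      exact Finset.mem_union_right _ (pc_self hd v)
    have := Finset.card_lt_card h3
    omega
  have hi : ∀ D ∈ CH, D ⊆ A → Disjoint D K → ∀ d ∈ D, ∀ x ∈ K, ¬ H.Adj x d := by
    intro D hD hDA' hDK d hdD x hx hadj
    have hpc := pc_of_mem hd hD hdD
    have hdK : d ∉ K := Finset.disjoint_left.1 hDK hdD
    have h1 : km k H A D + 1 ≤ km k H A (K ∪ D) - km k H A K :=
      km_adj hDK.symm hx hdD (hKA hx) (hDA' hdD) hadj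
    have h2 := hDm D hD hDA'
    apply hnogood d hdK
    have h3 := haddF d hdK (by
      rw [kc, hpc]
      apply max_le <;> linarith)
    have hsat := hKs.union (KSat.piece (pc_eq hd) d)
    rw [hpc] at h3 hsat ⊢
    refine ⟨Finset.union_subset hKF h3, hYK.trans Finset.subset_union_left, hsat,
      by linarith, ?_⟩
    intro z hz y hy hyA
    rcases Finset.mem_union.1 hz with hz | hz
    · exact hKo z hz y hy hyA
    · intro hadj'
      exact hout y hy hyA D hD hDA' z hz hadj'.symm
  refine ⟨K, hKF, hYK, hKs, hK0, hKo, hi, ?_⟩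
  rintro p hp hpK ⟨x, hx, hxp⟩
  have hpA : p ∈ A.map f := by
    by_contra hcon
    exact hKo x hx p hp hcon hxp
  obtain ⟨v, hvA, rfl⟩ := Finset.mem_map.1 hpA
  have hvK : v ∉ K := fun h => hpK (Finset.mem_map_of_mem f h)
  have hvD : ∀ D ∈ CH, v ∉ D := by
    intro D hD hvD
    have hDA' : D ⊆ A := by
      rcases hDA D hD with h | h
      · exact h
      · exact absurd hvA (Finset.disjoint_left.1 h hvD)
    have hDK : Disjoint D K := by
      have := hKs.disj (pc_eq hd) (pc_self hd) hvK
      rwa [pc_of_mem hd hD hvD] at this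
    exact hi D hD hDA' hDK v hvD x hx ((hf _ _).1 hxp)
  have hpc := pc_of_not_mem hvD
  by_contra hlt
  push Not at hlt
  have hsub : (A \ K).map f ⊆ Z \ K.map f := by
    intro y hy
    obtain ⟨a, ha, rfl⟩ := Finset.mem_map.1 hy
    obtain ⟨h1, h2⟩ := Finset.mem_sdiff.1 ha
    refine Finset.mem_sdiff.2 ⟨hAZ (Finset.mem_map_of_mem f h1), ?_⟩
    intro h3
    exact h2 ((Finset.mem_map' f).1 h3)
  obtain ⟨hle, heq⟩ := dg_map hf hsub v
  have hins := km_insert (k := k) (G := H) hvA hvK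
  have hadj1 : km k H A {v} + 1 ≤ km k H A (K ∪ {v}) - km k H A K :=
    km_adj (by simpa using hvK) hx (Finset.mem_singleton_self v) (hKA hx) hvA ((hf _ _).1 hxp)
  have h3 := haddF v hvK (by
      rw [kc, hpc]
      apply max_le
      · rw [hins]; omega
      · exact hadj1)
  have hsat := hKs.union (KSat.piece (pc_eq hd) v)
  have hng := hnogood v hvK
  rw [hpc] at h3 hsat hng
  have h4 := hFt _ hsat (hYK.trans Finset.subset_union_left) (Finset.union_subset hKF h3)
  have h5 : dg Ht (Z \ K.map f) (f v) ≤ dg H (A \ K) v := by omega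
  apply hng
  refine ⟨Finset.union_subset hKF h3, hYK.trans Finset.subset_union_left, hsat,
      by rw [hins]; omega, ?_⟩
  intro z hz y hy hyA
  rcases Finset.mem_union.1 hz with hz | hz
  · exact hKo z hz y hy hyA
  · rw [Finset.mem_singleton.1 hz]
    intro hadj'
    apply hyA
    have hy' : y ∈ Z \ K.map f := by
      refine Finset.mem_sdiff.2 ⟨hy, fun h => hyA ?_⟩
      exact Finset.map_subset_map.2 hKA h
    exact Finset.map_subset_map.2 Finset.sdiff_subset (heq h5 y hy' hadj')

/-- The inductive form of the key lemma. -/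
lemma key_induction {k : ℕ} (hk : 2 ≤ k) (H : SimpleGraph V) (CH : Finset (Finset V))
    (hd : ∀ D₁ ∈ CH, ∀ D₂ ∈ CH, D₁ ≠ D₂ → Disjoint D₁ D₂)
    (hDe : ∀ D ∈ CH, -1 ≤ km k H Finset.univ D)
    (hDdeg : ∀ D ∈ CH, ∀ v ∈ D, k ≤ dg H Finset.univ v)
    (hnosub : ¬ ∃ s : Finset V, s.Nonempty ∧ ∀ v ∈ s, k ≤ dg H s v) (A : Finset V) :
    (∀ D ∈ CH, D ⊆ A ∨ Disjoint D A) →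
    (∀ D ∈ CH, D ⊆ A → ∀ d ∈ D, ∀ y, y ∉ A → ¬ H.Adj d y) →
    ∃ (S : Finset V) (B : V → Finset V), S ⊆ A ∧ (∀ v, B v ⊆ A) ∧
      (∀ s ∈ S, dg H A s ≤ k - 1) ∧
      (∀ v ∈ A, dg H A v ≤ k - 2 → v ∈ S) ∧
      (∑ s ∈ S, ((k : ℤ) - (dg H A s : ℤ)) ≤ 2 * km k H A A) ∧
      (∀ u v : V, u ≠ v → Disjoint (B u) (B v)) ∧
      KExt k H CH A S B := by
  classical
  induction A using Finset.strongInduction with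
  | H A ih =>
  intro hDA hDn
  by_cases hA : A.Nonempty
  swap
  · rw [Finset.not_nonempty_iff_eq_empty] at hA
    subst hA
    refine ⟨∅, fun _ => ∅, subset_rfl, fun _ => subset_rfl, by simp, by simp, by simp [km_empty],
      by simp, ?_⟩
    intro W _ _ Ht f Z hf hAZ hprop hlow hout
    obtain ⟨x, hx, _⟩ := hprop
    refine ⟨Z, subset_rfl, ⟨x, hx⟩, ?_, le_rfl, ?_, ?_, ?_, ?_⟩
    · intro y hy
      by_contra hcon
      obtain ⟨v, hv, _⟩ := hlow y hy (by omega)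
      simp at hv
    · intro y h1 h2; exact absurd h1 h2
    · intro y h1 h2; exact absurd h1 h2
    · intro D hD hDe'
      left
      intro d hd'
      simpa using hDe' hd'
    · intro D hD _ _ d _ y h1 h2; exact absurd h1 h2
  -- facts about members of `CH` inside `A`
  have hDm : ∀ D ∈ CH, D ⊆ A → -1 ≤ km k H A D := by
    intro D hD hDA'
    have h1 := hDe D hD
    have h2 : eb H A D ≤ eb H Finset.univ D := by
      apply Finset.card_le_card
      intro e he
      rw [mem_ebS] at he ⊢
      exact ⟨he.1, fun _ _ => Finset.mem_univ _, he.2.2⟩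
    simp only [km] at h1 ⊢
    zify at h2
    linarith
  have hDd : ∀ D ∈ CH, D ⊆ A → ∀ v ∈ D, k ≤ dg H A v := by
    intro D hD hDA' v hv
    rw [dg_eq_of_not_adj (Finset.subset_univ A) (fun y _ hy => hDn D hD hDA' v hv y hy)]
    exact hDdeg D hD v hv
  have hDin : ∀ D ∈ CH, ∀ v ∈ D, v ∈ A → D ⊆ A := by
    intro D hD v hv hvA
    rcases hDA D hD with h | h
    · exact h
    · exact absurd hvA (Finset.disjoint_left.1 h hv)
  set L := A.filter (fun v => dg H A v ≤ k - 1) with hLdef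
  have hmemL : ∀ v, v ∈ L ↔ v ∈ A ∧ dg H A v ≤ k - 1 := fun v => by simp [hLdef]
  have hLA : L ⊆ A := Finset.filter_subset _ _
  have hLne : L.Nonempty := by
    by_contra hcon
    apply hnosub
    refine ⟨A, hA, fun v hv => ?_⟩
    by_contra hlt
    exact hcon ⟨v, (hmemL v).2 ⟨hv, by omega⟩⟩
  have hLD : ∀ v ∈ L, ∀ D ∈ CH, v ∉ D := by
    intro v hv D hD hvD
    rw [hmemL] at hv
    have := hDd D hD (hDin D hD v hvD hv.1) v hvD
    omega
  have hLp : ∀ v ∈ L, pc CH v = {v} := fun v hv => pc_of_not_mem (hLD v hv)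
  have hLk : ∀ v ∈ L, km k H A {v} = (k : ℤ) - 1 - dg H A v := fun v hv => km_singleton (hLA hv)
  have hLm : ∀ v ∈ L, 0 ≤ km k H A {v} := by
    intro v hv
    rw [hLk v hv]
    have := ((hmemL v).1 hv).2
    omega
  have hLc : ∀ v ∈ L, kc (km k H A) (pc CH) v = (k : ℤ) - dg H A v := by
    intro v hv
    rw [kc, hLp v hv, max_eq_right (by linarith [hLm v hv]), hLk v hv]
    ring
  obtain ⟨R, T, sh, g, hRL, hRT, hTne, hTs, hTc, hTmin, hTsum, hsh⟩ :=
    abstract_main (m := km k H A) (P := pc CH) km_empty km_sup (pc_self hd) (pc_eq hd) L hLp hLm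
  have hAs : KSat (pc CH) A := by
    intro v hv
    by_cases h : ∃ D ∈ CH, v ∈ D
    · obtain ⟨D, hD, hvD⟩ := h
      rw [pc_of_mem hd hD hvD]
      exact hDin D hD v hvD hv
    · push Not at h
      rw [pc_of_not_mem h]
      simpa using hv
  have hTA : T ⊆ A := by
    refine hTmin A hAs ?_ hLA
    intro v hv
    rw [km_outside (hAs.disj (pc_eq hd) (pc_self hd) hv)]
    have : km k H A (pc CH v) + 1 ≤ kc (km k H A) (pc CH) v := le_max_right _ _
    linarith
  have hTne' := hTne hLne
  set A' := A \ T with hA'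
  have hA'A : A' ⊆ A := Finset.sdiff_subset
  have hmemA' : ∀ v, v ∈ A' ↔ v ∈ A ∧ v ∉ T := fun v => by simp [hA']
  have hss : A' ⊂ A := by
    refine ⟨hA'A, fun h => ?_⟩
    obtain ⟨t, ht⟩ := hTne'
    exact ((hmemA' t).1 (h (hTA ht))).2 ht
  -- members of `CH` and `T`
  have hDT : ∀ D ∈ CH, D ⊆ A → D ⊆ T ∨ D ⊆ A' := by
    intro D hD hDA'
    by_cases h : ∃ v ∈ D, v ∈ T
    · obtain ⟨v, hv, hvT⟩ := h
      left
      have := hTs v hvT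
      rwa [pc_of_mem hd hD hv] at this
    · push Not at h
      right
      intro v hv
      exact (hmemA' v).2 ⟨hDA' hv, h v hv⟩
  have hDTn : ∀ D ∈ CH, D ⊆ A' → ∀ d ∈ D, ∀ t ∈ T, ¬ H.Adj t d := by
    intro D hD hDA' d hdD t ht hadj
    have hdT : d ∉ T := ((hmemA' d).1 (hDA' hdD)).2
    have hdis : Disjoint T D := by
      rw [Finset.disjoint_left]
      intro a haT haD
      exact ((hmemA' a).1 (hDA' haD)).2 haT
    have h1 : km k H A D + 1 ≤ km k H A (T ∪ D) - km k H A T :=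
      km_adj hdis ht hdD (hTA ht) (hA'A (hDA' hdD)) hadj
    have h2 := hTc d hdT
    rw [kc, pc_of_mem hd hD hdD] at h2
    have h3 := hDm D hD (hDA'.trans hA'A)
    rw [max_eq_right (by linarith)] at h2
    linarith
  obtain ⟨S', B', hS'A, hB'A, hS'low, hS'2, hS'sum, hB'dis, hext⟩ := ih A' hss
    (by
      intro D hD
      rcases hDA D hD with h | h
      · rcases hDT D hD h with h' | h'
        · right
          rw [Finset.disjoint_left]
          intro a haD haA'
          exact ((hmemA' a).1 haA').2 (h' haD)
        · exact Or.inl h'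
      · exact Or.inr (Finset.disjoint_of_subset_right hA'A h))
    (by
      intro D hD hDA' d hdD y hy hadj
      by_cases hyA : y ∈ A
      · have hyT : y ∈ T := by
          by_contra h
          exact hy ((hmemA' y).2 ⟨hyA, h⟩)
        exact hDTn D hD hDA' d hdD y hyT hadj.symm
      · exact hDn D hD (hDA'.trans hA'A) d hdD y hyA hadj)
  have hRk : ∀ v ∈ R, dg H A v = k - 1 := by
    intro v hv
    have h1 := hsh {v} (by simpa using hv)
    have h2 := h1.2.2.2.2.2.1 {v} (by
      intro u hu
      rw [Finset.mem_singleton.1 hu, hLp v (hRL hv)]) subset_rfl h1.1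
    rw [hLk v (hRL hv)] at h2
    have := ((hmemL v).1 (hRL hv)).2
    omega
  refine ⟨(S' ∩ L) ∪ ((T ∩ L) \ R),
    fun v => if v ∈ T then (if v ∈ R then T.filter (fun z => g z = v) else ∅) else B' v,
    ?_, ?_, ?_, ?_, ?_, ?_, ?_⟩
  · apply Finset.union_subset
    · exact Finset.inter_subset_right.trans hLA
    · exact (Finset.sdiff_subset.trans Finset.inter_subset_right).trans hLA
  · intro v
    dsimp only
    split_ifs
    · exact (Finset.filter_subset _ _).trans hTA
    · simp
    · exact (hB'A v).trans hA'A
  · intro s hs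
    have : s ∈ L := by
      rcases Finset.mem_union.1 hs with h | h
      · exact (Finset.mem_inter.1 h).2
      · exact (Finset.mem_inter.1 (Finset.mem_sdiff.1 h).1).2
    exact ((hmemL s).1 this).2
  · intro v hvA hv
    have hvL : v ∈ L := (hmemL v).2 ⟨hvA, by omega⟩
    by_cases hvT : v ∈ T
    · apply Finset.mem_union_right
      refine Finset.mem_sdiff.2 ⟨Finset.mem_inter.2 ⟨hvT, hvL⟩, fun hvR => ?_⟩
      have := hRk v hvR
      omega
    · apply Finset.mem_union_left
      refine Finset.mem_inter.2 ⟨hS'2 v ((hmemA' v).2 ⟨hvA, hvT⟩) ?_, hvL⟩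
      exact (dg_mono hA'A v).trans hv
  · have hdis : Disjoint (S' ∩ L) ((T ∩ L) \ R) := by
      rw [Finset.disjoint_left]
      intro a h1 h2
      exact ((hmemA' a).1 (hS'A (Finset.mem_inter.1 h1).1)).2
        (Finset.mem_inter.1 (Finset.mem_sdiff.1 h2).1).1
    rw [Finset.sum_union hdis, km_split hTA]
    have h1 : ∑ s ∈ (T ∩ L) \ R, ((k : ℤ) - (dg H A s : ℤ)) ≤ 2 * km k H A T := by
      refine le_trans (le_of_eq ?_) hTsum
      apply Finset.sum_congr rfl
      intro v hv
      rw [hLc v (Finset.mem_inter.1 (Finset.mem_sdiff.1 hv).1).2]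
    have h2 : ∑ s ∈ S' ∩ L, ((k : ℤ) - (dg H A s : ℤ)) ≤
        ∑ s ∈ S', ((k : ℤ) - (dg H A' s : ℤ)) := by
      calc ∑ s ∈ S' ∩ L, ((k : ℤ) - (dg H A s : ℤ))
          ≤ ∑ s ∈ S' ∩ L, ((k : ℤ) - (dg H A' s : ℤ)) := by
            apply Finset.sum_le_sum
            intro s _
            have := dg_mono (G := H) hA'A s
            omega
        _ ≤ _ := by
            apply Finset.sum_le_sum_of_subset_of_nonneg Finset.inter_subset_left
            intro s hs _
            have := hS'low s hs
            omega
    linarith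
  · intro u v huv
    have hB'T : ∀ v, Disjoint T (B' v) := by
      intro v
      rw [Finset.disjoint_left]
      intro a h1 h2
      exact ((hmemA' a).1 (hB'A v h2)).2 h1
    dsimp only
    split_ifs
    · rw [Finset.disjoint_left]
      intro a h1 h2
      exact huv ((Finset.mem_filter.1 h1).2.symm.trans (Finset.mem_filter.1 h2).2)
    · simp
    · exact Finset.disjoint_of_subset_left (Finset.filter_subset _ _) (hB'T v)
    · simp
    · simp
    · simp
    · exact Finset.disjoint_of_subset_right (Finset.filter_subset _ _) (hB'T u).symm
    · simp
    · exact hB'dis u v huv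
  · intro W _ _ Ht f Z hf hAZ hprop hlow hout
    set Y := R.filter (fun v => dg Ht Z (f v) ≤ k - 1) with hYdef
    have hYR : Y ⊆ R := Finset.filter_subset _ _
    obtain ⟨hYF, hFT, hFs, hFc, hY0, hFt, hgF⟩ := hsh Y hYR
    obtain ⟨K, hKF, hYK, hKs, hK0, hKo, hKD, hKc⟩ := deletion_step (k := k) (H := H) (CH := CH)
      (Ht := Ht) (f := f) (Z := Z) (Y := Y) (F := sh Y)
      hk hd hDm hDA ((hYR.trans hRT).trans hTA) (hFT.trans hTA) hYF
      (fun v hv => (hRk v (hYR hv)).ge)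
      (by
        intro v hv
        rw [hLp v (hRL (hYR hv))]
        simpa using hv) hFs hFc hY0 hFt hf hAZ
      (fun v hv => (Finset.mem_filter.1 hv).2) hout
    have hKT := hKF.trans hFT
    set Z₂ := Z \ K.map f with hZ₂
    have hZ₂Z : Z₂ ⊆ Z := Finset.sdiff_subset
    have hmemZ₂ : ∀ x, x ∈ Z₂ ↔ x ∈ Z ∧ x ∉ K.map f := fun x => by rw [hZ₂, Finset.mem_sdiff]
    have hKmapA : K.map f ⊆ A.map f := Finset.map_subset_map.2 (hKT.trans hTA)
    have hlow2 : ∀ x ∈ Z₂, dg Ht Z₂ x ≤ k - 1 → dg Ht Z x ≤ k - 1 := by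
      intro x hx hxl
      rw [hmemZ₂] at hx
      rw [← dg_eq_of_not_adj hZ₂Z]
      · exact hxl
      · intro y hy hyZ₂ hadj
        have hyK : y ∈ K.map f := by
          by_contra h
          exact hyZ₂ ((hmemZ₂ y).2 ⟨hy, h⟩)
        obtain ⟨a, ha, rfl⟩ := Finset.mem_map.1 hyK
        have := hKc x hx.1 hx.2 ⟨a, ha, hadj.symm⟩
        omega
    have hA'map : ∀ v, f v ∈ A'.map f ↔ v ∈ A' := fun v => Finset.mem_map' f
    have hA'Z₂ : A'.map f ⊆ Z₂ := by
      intro y hy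
      obtain ⟨a, ha, rfl⟩ := Finset.mem_map.1 hy
      rw [hmemZ₂]
      refine ⟨hAZ (Finset.mem_map_of_mem f (hA'A ha)), fun h => ?_⟩
      exact ((hmemA' a).1 ha).2 (hKT ((Finset.mem_map' f).1 h))
    have houtZ₂ : ∀ y ∈ Z, y ∉ A.map f → y ∈ Z₂ ∧ y ∉ A'.map f := by
      intro y hy hyA
      exact ⟨(hmemZ₂ y).2 ⟨hy, fun h => hyA (hKmapA h)⟩,
        fun h => hyA (Finset.map_subset_map.2 hA'A h)⟩
    obtain ⟨s, hsZ, hsne, hsa, hsb, hsc, hsd, hse, hsf⟩ := hext W Ht f Z₂ hf hA'Z₂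
      (by
        obtain ⟨x, hx, hxA⟩ := hprop
        exact ⟨x, houtZ₂ x hx hxA⟩)
      (by
        intro x hx hxl
        obtain ⟨v, hvA, hvl, hvS, rfl⟩ := hlow x (hZ₂Z hx) (hlow2 x hx hxl)
        have hvL : v ∈ L := (hmemL v).2 ⟨hvA, hvl⟩
        have hvT : v ∉ T := by
          intro hvT
          have hvR : v ∈ R := by
            by_contra hvR
            exact hvS (Finset.mem_union_right _
              (Finset.mem_sdiff.2 ⟨Finset.mem_inter.2 ⟨hvT, hvL⟩, hvR⟩))
          have hvY : v ∈ Y := Finset.mem_filter.2 ⟨hvR, hlow2 _ hx hxl⟩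
          exact ((hmemZ₂ _).1 hx).2 (Finset.mem_map_of_mem f (hYK hvY))
        refine ⟨v, (hmemA' v).2 ⟨hvA, hvT⟩, (dg_mono hA'A v).trans hvl, fun h => ?_, rfl⟩
        exact hvS (Finset.mem_union_left _ (Finset.mem_inter.2 ⟨h, hvL⟩)))
      (by
        intro x hx hxA' D hD hDA' d hdD hadj
        by_cases hxA : x ∈ A.map f
        · obtain ⟨a, ha, rfl⟩ := Finset.mem_map.1 hxA
          have haT : a ∈ T := by
            by_contra h
            exact hxA' (Finset.mem_map_of_mem f ((hmemA' a).2 ⟨ha, h⟩))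
          exact hDTn D hD hDA' d hdD a haT ((hf _ _).1 hadj)
        · exact hout x (hZ₂Z hx) hxA D hD (hDA'.trans hA'A) d hdD hadj)
    -- elements of `T` not in `K` survive
    have hTs' : ∀ t ∈ T, t ∉ K → f t ∈ s := by
      intro t ht htK
      by_contra hts
      have htZ₂ : f t ∈ Z₂ := (hmemZ₂ _).2 ⟨hAZ (Finset.mem_map_of_mem f (hTA ht)),
        fun h => htK ((Finset.mem_map' f).1 h)⟩
      obtain ⟨v, _, _, b, hb, hfb⟩ := hsc (f t) htZ₂ hts
      have := hB'A v hb
      rw [f.injective hfb] at this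
      exact ((hmemA' t).1 this).2 ht
    refine ⟨s, hsZ.trans hZ₂Z, hsne, hsa, ?_, ?_, ?_, ?_, ?_⟩
    · have h1 : km k Ht Z Z = km k Ht Z (K.map f) + km k Ht Z₂ Z₂ := km_split (hKmapA.trans hAZ)
      have h2 : km k H A K ≤ km k Ht Z (K.map f) := km_map hf hKo (hKT.trans hTA)
      linarith
    · intro x hx hxs
      by_cases hxK : x ∈ K.map f
      · obtain ⟨z, hz, rfl⟩ := Finset.mem_map.1 hxK
        have hgY := hgF z (hKF hz)
        have hgR := hYR hgY
        refine ⟨g z, hLA (hRL hgR), (Finset.mem_filter.1 hgY).2, z, ?_, rfl⟩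
        dsimp only
        rw [if_pos (hRT hgR), if_pos hgR]
        exact Finset.mem_filter.2 ⟨hKT hz, rfl⟩
      · have hxZ₂ := (hmemZ₂ x).2 ⟨hx, hxK⟩
        obtain ⟨v, hvA', hvl, b, hb, hfb⟩ := hsc x hxZ₂ hxs
        refine ⟨v, hA'A hvA', hlow2 _ (hA'Z₂ (Finset.mem_map_of_mem f hvA')) hvl, b, ?_, hfb⟩
        dsimp only
        rw [if_neg ((hmemA' v).1 hvA').2]
        exact hb
    · intro x hx hxs y hy hyA
      by_cases hxK : x ∈ K.map f
      · obtain ⟨z, hz, rfl⟩ := Finset.mem_map.1 hxK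
        exact hKo z hz y hy hyA
      · have h := houtZ₂ y hy hyA
        exact hsd x ((hmemZ₂ x).2 ⟨hx, hxK⟩) hxs y h.1 h.2
    · intro D hD hDA'
      rcases hDT D hD hDA' with h | h
      · by_cases hK' : ∃ v ∈ D, v ∈ K
        · obtain ⟨v, hv, hvK⟩ := hK'
          right
          have hDK := hKs v hvK
          rw [pc_of_mem hd hD hv] at hDK
          intro d hdD hds
          exact ((hmemZ₂ _).1 (hsZ hds)).2 (Finset.mem_map_of_mem f (hDK hdD))
        · push Not at hK'
          left
          intro d hdD
          exact hTs' d (h hdD) (hK' d hdD)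
      · exact hse D hD h
    · intro D hD hDA' hDs d hdD y hy hys hadj
      have hDK : Disjoint D K := by
        rw [Finset.disjoint_left]
        intro a haD haK
        exact ((hmemZ₂ _).1 (hsZ (hDs a haD))).2 (Finset.mem_map_of_mem f haK)
      by_cases hyK : y ∈ K.map f
      · obtain ⟨z, hz, rfl⟩ := Finset.mem_map.1 hyK
        exact hKD D hD hDA' hDK d hdD z hz ((hf _ _).1 hadj.symm)
      · have hyZ₂ := (hmemZ₂ y).2 ⟨hy, hyK⟩
        rcases hDT D hD hDA' with h | h
        · refine hsd y hyZ₂ hys (f d) (hsZ (hDs d hdD)) ?_ hadj.symm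
          intro hcon
          exact ((hmemA' d).1 ((hA'map d).1 hcon)).2 (h hdD)
        · exact hsf D hD h hDs d hdD y hyZ₂ hys hadj

lemma dg_eq_card (G : SimpleGraph V) [DecidableRel G.Adj] (A : Finset V) (v : V) :
    dg G A v = (A.filter (fun u => G.Adj v u)).card := by
  unfold dg
  congr

lemma dg_univ (G : SimpleGraph V) [DecidableRel G.Adj] (v : V) :
    dg G Finset.univ v = G.degree v := by
  rw [dg_eq_card, ← SimpleGraph.card_neighborFinset_eq_degree, SimpleGraph.neighborFinset_eq_filter]

lemma eb_self (G : SimpleGraph V) [DecidableRel G.Adj] (A : Finset V) :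
    eb G A A = (G.edgeFinset.filter (fun e => ∀ x ∈ e, x ∈ A)).card := by
  unfold eb
  congr 1
  ext e
  rw [mem_ebS, Finset.mem_filter, SimpleGraph.mem_edgeFinset]
  constructor
  · rintro ⟨h1, h2, _⟩; exact ⟨h1, h2⟩
  · rintro ⟨h1, h2⟩
    refine ⟨h1, h2, ?_⟩
    induction e using Sym2.ind with
    | _ a b => exact ⟨a, h2 a (by simp), by simp⟩

lemma eb_univ_self (G : SimpleGraph V) [DecidableRel G.Adj] :
    eb G Finset.univ Finset.univ = G.edgeFinset.card := by
  rw [eb_self]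
  simp

end Main

/-- **Key lemma (Lemma 3.1).** If `H` has no non-empty subgraph of minimum degree at least
`k`, then there exist a set `S` of vertices of degree at most `k-1`, containing all vertices
of degree at most `k-2`, with `Σ_{s∈S}(k - deg_H(s)) ≤ 2((k-1)v(H) - e(H))`, and pairwise
disjoint sets `B_v` for the remaining vertices of degree at most `k-1`, such that whenever
`H̃` contains `H` as a proper induced subgraph (via the embedding `f`) with
`V_{≤k-1}(H̃) ⊆ V_{≤k-1}(H)\S` and no vertex of `V(H̃)\V(H)` adjacent to any member of `C_H`,
there is a non-empty induced subgraph `H̃'` (with vertex set `s`) satisfying properties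
(a)–(f). -/
theorem key_lemma {V : Type u} [Fintype V] [DecidableEq V]
    (k : ℕ) (hk : 2 ≤ k) (H : SimpleGraph V) [DecidableRel H.Adj]
    (CH : Finset (Finset V))
    (hCHne : ∀ D ∈ CH, D.Nonempty)
    (hCHdisj : ∀ D₁ ∈ CH, ∀ D₂ ∈ CH, D₁ ≠ D₂ → Disjoint D₁ D₂)
    (hCHe : ∀ D ∈ CH, eBar H D ≤ (k - 1) * D.card + 1)
    (hCHdeg : ∀ D ∈ CH, ∀ v ∈ D, k ≤ H.degree v)
    (hnosub : ¬ ∃ s : Finset V, s.Nonempty ∧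
        ∀ v ∈ s, k ≤ (s.filter (fun u => H.Adj v u)).card) :
    ∃ (S : Finset V) (B : V → Finset V),
      (∀ s ∈ S, H.degree s ≤ k - 1) ∧
      (∀ v : V, H.degree v ≤ k - 2 → v ∈ S) ∧
      (∑ s ∈ S, ((k : ℤ) - (H.degree s : ℤ)) ≤
          2 * (((k : ℤ) - 1) * (Fintype.card V : ℤ) - (H.edgeFinset.card : ℤ))) ∧
      (∀ u v : V, u ≠ v → H.degree u ≤ k - 1 → u ∉ S → H.degree v ≤ k - 1 → v ∉ S →
          Disjoint (B u) (B v)) ∧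
      (∀ (W : Type u) [Fintype W] [DecidableEq W]
          (Ht : SimpleGraph W) [DecidableRel Ht.Adj] (f : V ↪ W),
        -- `H̃` contains `H` as an induced subgraph …
        (∀ u v : V, Ht.Adj (f u) (f v) ↔ H.Adj u v) →
        -- … which is proper,
        (∃ x : W, ∀ v : V, f v ≠ x) →
        -- `V_{≤k-1}(H̃) ⊆ V_{≤k-1}(H)\S`,
        (∀ x : W, Ht.degree x ≤ k - 1 →
            ∃ v : V, H.degree v ≤ k - 1 ∧ v ∉ S ∧ f v = x) →
        -- and no vertex of `V(H̃)\V(H)` is adjacent to any member of `C_H`.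
        (∀ x : W, (∀ v : V, f v ≠ x) → ∀ D ∈ CH, ∀ d ∈ D, ¬ Ht.Adj x (f d)) →
        -- Then there is a non-empty induced subgraph `H̃'` of `H̃`, with vertex set `s`:
        ∃ s : Finset W, s.Nonempty ∧
          -- (a) the minimum degree of `H̃'` is at least `k`;
          (∀ x ∈ s, k ≤ (s.filter (fun y => Ht.Adj x y)).card) ∧
          -- (b) `(k-1)v(H̃') - e(H̃') ≤ (k-1)v(H̃) - e(H̃)`;
          (((k : ℤ) - 1) * (s.card : ℤ) -
              ((Ht.edgeFinset.filter (fun e => ∀ x ∈ e, x ∈ s)).card : ℤ) ≤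
            ((k : ℤ) - 1) * (Fintype.card W : ℤ) - (Ht.edgeFinset.card : ℤ)) ∧
          -- (c) `V(H̃)\V(H̃') ⊆ ⋃_{v ∈ V_{≤k-1}(H̃)} B_v`;
          (∀ x : W, x ∉ s → ∃ v : V, Ht.degree (f v) ≤ k - 1 ∧ ∃ b ∈ B v, f b = x) ∧
          -- (d) no vertex of `V(H̃)\V(H̃')` is adjacent to any vertex of `V(H̃)\V(H)`;
          (∀ x : W, x ∉ s → ∀ y : W, (∀ v : V, f v ≠ y) → ¬ Ht.Adj x y) ∧
          -- (e) each `D ∈ C_H` is contained in or disjoint from `V(H̃')`;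
          (∀ D ∈ CH, (∀ d ∈ D, f d ∈ s) ∨ (∀ d ∈ D, f d ∉ s)) ∧
          -- (f) each `D ∈ C_H` inside `V(H̃')` has no neighbour in `V(H̃)\V(H̃')`.
          (∀ D ∈ CH, (∀ d ∈ D, f d ∈ s) → ∀ d ∈ D, ∀ y ∉ s, ¬ Ht.Adj (f d) y)) := by
  have hk1 : (1 : ℕ) ≤ k := by omega
  have hebar : ∀ D, eb H Finset.univ D = eBar H D := by
    intro D
    unfold eb eBar
    congr 1
    ext e
    rw [mem_ebS, Finset.mem_filter, SimpleGraph.mem_edgeFinset]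
    simp
  obtain ⟨S, B, _, _, hSlow, hS2, hSsum, hB, hext⟩ := key_induction hk H CH hCHdisj
    (by
      intro D hD
      have h := hCHe D hD
      rw [km, hebar]
      zify [hk1] at h
      linarith)
    (by
      intro D hD v hv
      rw [dg_univ]
      exact hCHdeg D hD v hv)
    (by
      rintro ⟨s, hs, h⟩
      refine hnosub ⟨s, hs, fun v hv => ?_⟩
      rw [← dg_eq_card]
      exact h v hv)
    Finset.univ (fun D _ => Or.inl (Finset.subset_univ D))
    (fun D _ _ d _ y hy => absurd (Finset.mem_univ y) hy)
  have hmap : ∀ {W : Type u} (f : V ↪ W) (x : W),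
      x ∉ (Finset.univ : Finset V).map f ↔ ∀ v, f v ≠ x := by
    intro W f x
    simp
  refine ⟨S, B, ?_, ?_, ?_, ?_, ?_⟩
  · intro s hs
    rw [← dg_univ]
    exact hSlow s hs
  · intro v hv
    rw [← dg_univ] at hv
    exact hS2 v (Finset.mem_univ v) hv
  · simp only [km, eb_univ_self, dg_univ, Finset.card_univ] at hSsum
    exact hSsum
  · intro u v huv _ _ _ _
    exact hB u v huv
  · intro W _ _ Ht _ f hf hprop hlow hout
    obtain ⟨s, _, hsne, hsa, hsb, hsc, hsd, hse, hsf⟩ := hext W Ht f Finset.univ hf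
      (Finset.subset_univ _)
      (by
        obtain ⟨x, hx⟩ := hprop
        exact ⟨x, Finset.mem_univ x, (hmap f x).2 hx⟩)
      (by
        intro x _ hx
        rw [dg_univ] at hx
        obtain ⟨v, h1, h2, h3⟩ := hlow x hx
        refine ⟨v, Finset.mem_univ v, ?_, h2, h3⟩
        rw [dg_univ]
        exact h1)
      (by
        intro x _ hx D hD _ d hd
        exact hout x ((hmap f x).1 hx) D hD d hd)
    refine ⟨s, hsne, ?_, ?_, ?_, ?_, ?_, ?_⟩
    · intro x hx
      rw [← dg_eq_card]
      exact hsa x hx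
    · simp only [km, eb_univ_self, Finset.card_univ] at hsb
      rw [eb_self] at hsb
      exact hsb
    · intro x hx
      obtain ⟨v, _, h1, h2⟩ := hsc x (Finset.mem_univ x) hx
      rw [dg_univ] at h1
      exact ⟨v, h1, h2⟩
    · intro x hx y hy
      exact hsd x (Finset.mem_univ x) hx y (Finset.mem_univ y) ((hmap f y).2 hy)
    · intro D hD
      exact hse D hD (Finset.subset_univ D)
    · intro D hD hDs d hd y hy
      exact hsf D hD (Finset.subset_univ D) hDs d hd y (Finset.mem_univ y) hy
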